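/- arXiv:2501.18496 — 5 statements merged into one kernel-verified Lean document; each statement's English description precedes it below -/
import Mathlib

section
/- Assume w satisfies the nearest-neighbor condition along the identity ordering. Then for every permutation σ of Fin n with σ(0) = 0 and σ(n−1) = n−1 (i.e., any Hamiltonian path from vertex 0 to vertex n−1), one has ∑_{i=0}^{n−2} w(i, i+1) ≤ ((1+α)/2) · ∑_{i=0}^{n−2} w(σ(i), σ(i+1)). (Combinatorial core of Theorem 4: the adaptive exploration algorithm, which follows a nearest-neighbor Hamiltonian path, achieves competitive ratio at most (α+1)/2 against any Hamiltonian path with the same endpoints.) -/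
open Finset

/-- Charging inequality: if every fibre of `m` has at most two elements and `d` takes values in
`[1, α]`, then `∑ d ≤ (1 + α) / 2 * ∑ d ∘ m`. -/
theorem sum_le_half_one_add_mul_sum_comp {ι : Type*} [Fintype ι] [DecidableEq ι]
    {α : ℝ} {d : ι → ℝ} (hd1 : ∀ i, 1 ≤ d i) (hdα : ∀ i, d i ≤ α) (m : ι → ι)
    (hm : ∀ i, #{k | m k = i} ≤ 2) :
    ∑ i, d i ≤ (1 + α) / 2 * ∑ k, d (m k) := by
  have hsum : ∑ k, d (m k) = ∑ i, (#{k | m k = i} : ℝ) * d i := by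
    rw [← sum_fiberwise' univ m d]
    simp
  have hcard : ∑ i, (1 - (#{k | m k = i} : ℝ)) = 0 := by
    have h := sum_fiberwise' univ m (fun _ => (1 : ℝ))
    simp only [sum_const, nsmul_eq_mul, mul_one] at h
    rw [sum_sub_distrib, h]
    simp
  calc ∑ i, d i
      ≤ ∑ i, ((1 + α) / 2 * ((#{k | m k = i} : ℝ) * d i)
          + α * (1 - (#{k | m k = i} : ℝ))) := by
        refine sum_le_sum fun i _ => ?_
        have h1 := hd1 i
        have h2 := hdα i
        have hc := hm i
        generalize #{k | m k = i} = c at hc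
        interval_cases c <;> push_cast <;> nlinarith
    _ = (1 + α) / 2 * ∑ k, d (m k) := by
        rw [sum_add_distrib, ← mul_sum, ← mul_sum, hcard, hsum, mul_zero, add_zero]

/-- If `a` and `b` are injective, at most two indices `k` satisfy `min (a k) (b k) = i`. -/
theorem card_filter_min_eq_le_two {ι β : Type*} [Fintype ι] [LinearOrder β]
    {a b : ι → β} (ha : a.Injective) (hb : b.Injective) (i : β) :
    #{k | min (a k) (b k) = i} ≤ 2 := by
  classical
  have hle_one : ∀ {f : ι → β}, f.Injective → #{k | f k = i} ≤ 1 := fun hf =>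
    card_le_one.2 fun x hx y hy =>
      hf ((mem_filter.1 hx).2.trans (mem_filter.1 hy).2.symm)
  calc #{k | min (a k) (b k) = i}
      ≤ #(({k | a k = i} : Finset ι) ∪ ({k | b k = i} : Finset ι)) := by
        refine card_le_card fun k hk => ?_
        simp only [mem_union, mem_filter, mem_univ, true_and] at hk ⊢
        rcases min_choice (a k) (b k) with h | h
        · exact Or.inl (h.symm.trans hk)
        · exact Or.inr (h.symm.trans hk)
    _ ≤ 2 := (card_union_le _ _).trans (Nat.add_le_add (hle_one ha) (hle_one hb))

/-- **Combinatorial core of Theorem 4.**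
On the complete graph on `Fin n` (`n ≥ 2`) with symmetric weights in `[1, α]`, `1 ≤ α < 2`,
if the weights satisfy the nearest-neighbor condition along the identity ordering,
then the identity Hamiltonian path from `0` to `n-1` costs at most `(1+α)/2` times
any Hamiltonian path from `0` to `n-1` (given by a permutation `σ` fixing the endpoints). -/
theorem nearest_neighbor_path_competitive
    (n : ℕ) (hn : 2 ≤ n) (α : ℝ) (hα1 : 1 ≤ α) (hα2 : α < 2)
    (w : Fin n → Fin n → ℝ)
    (hsymm : ∀ i j : Fin n, w i j = w j i)
    (hlb : ∀ i j : Fin n, i ≠ j → 1 ≤ w i j)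
    (hub : ∀ i j : Fin n, i ≠ j → w i j ≤ α)
    (hNN : ∀ (i j : Fin n) (hi : (i : ℕ) + 1 < n),
      (i : ℕ) < (j : ℕ) → w i ⟨(i : ℕ) + 1, hi⟩ ≤ w i j)
    (σ : Equiv.Perm (Fin n))
    (hσ0 : σ ⟨0, by omega⟩ = ⟨0, by omega⟩)
    (hσn : σ ⟨n - 1, by omega⟩ = ⟨n - 1, by omega⟩) :
    ∑ i : Fin (n - 1), w ⟨(i : ℕ), by have := i.isLt; omega⟩ ⟨(i : ℕ) + 1, by have := i.isLt; omega⟩ ≤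
      (1 + α) / 2 *
        ∑ i : Fin (n - 1), w (σ ⟨(i : ℕ), by have := i.isLt; omega⟩)
          (σ ⟨(i : ℕ) + 1, by have := i.isLt; omega⟩) := by
  let a : Fin (n - 1) → Fin n := fun k => σ ⟨(k : ℕ), by have := k.isLt; omega⟩
  let b : Fin (n - 1) → Fin n := fun k => σ ⟨(k : ℕ) + 1, by have := k.isLt; omega⟩
  let d : Fin (n - 1) → ℝ := fun i =>
    w ⟨(i : ℕ), by have := i.isLt; omega⟩ ⟨(i : ℕ) + 1, by have := i.isLt; omega⟩
  have ha : a.Injective := fun x y h => by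
    simpa [Fin.ext_iff] using σ.injective h
  have hb : b.Injective := fun x y h => by
    simpa [Fin.ext_iff] using σ.injective h
  have hab : ∀ k, a k ≠ b k := fun k h => by
    simpa [Fin.ext_iff] using σ.injective h
  let m : Fin (n - 1) → Fin (n - 1) := fun k => ⟨min (a k : ℕ) (b k : ℕ), by
    have h1 := (a k).isLt
    have h2 := (b k).isLt
    have h3 := Fin.val_ne_of_ne (hab k)
    omega⟩
  have hm : ∀ i, #{k | m k = i} ≤ 2 := fun i => by
    have h := card_filter_min_eq_le_two (Fin.val_injective.comp ha)
      (Fin.val_injective.comp hb) (i : ℕ)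
    simpa only [m, Fin.ext_iff, Function.comp_apply] using h
  have hd1 : ∀ i, 1 ≤ d i := fun i => hlb _ _ (by simp [Fin.ext_iff])
  have hdα : ∀ i, d i ≤ α := fun i => hub _ _ (by simp [Fin.ext_iff])
  have hopt : ∀ k, d (m k) ≤ w (a k) (b k) := fun k => by
    have hmk : (m k : ℕ) + 1 < n := by have := (m k).isLt; omega
    rcases lt_or_gt_of_ne (Fin.val_ne_of_ne (hab k)) with h | h
    · have hv : (⟨(m k : ℕ), by omega⟩ : Fin n) = a k := Fin.ext (min_eq_left h.le)
      have := hNN ⟨(m k : ℕ), by omega⟩ (b k) hmk (by rw [hv]; exact h)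
      exact this.trans_eq (by rw [hv])
    · have hv : (⟨(m k : ℕ), by omega⟩ : Fin n) = b k := Fin.ext (min_eq_right h.le)
      have := hNN ⟨(m k : ℕ), by omega⟩ (a k) hmk (by rw [hv]; exact h)
      rw [hsymm (a k)]
      exact this.trans_eq (by rw [hv])
  exact (sum_le_half_one_add_mul_sum_comp hd1 hdα m hm).trans
    (mul_le_mul_of_nonneg_left (sum_le_sum fun k _ => hopt k) (by linarith))
end

section
/- Every path in G starting at s that does not visit t can be extended to a Hamiltonian path of G from s to t: if W is a path of G from s to some vertex v with t not in the support of W, then there exists a walk W' from v to t such that the concatenation of W and W' is a Hamiltonian path of G from s to t. (This verifies, for complete graphs, the hypothesis of Theorem 4 that each path can be extended to a Hamiltonian path from the start to the end vertex, as used in Corollary 1.) -/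
/-- In a complete graph, every list of vertices without repetitions is traversed by a walk. -/
theorem exists_walk_top_support_eq {V : Type*} (l : List V) (v t : V)
    (h : (v :: (l ++ [t])).Nodup) :
    ∃ p : (⊤ : SimpleGraph V).Walk v t, p.support = v :: (l ++ [t]) := by
  induction l generalizing v with
  | nil =>
    have hvt : (⊤ : SimpleGraph V).Adj v t := by simpa using h
    exact ⟨hvt.toWalk, by simp⟩
  | cons a l ih =>
    obtain ⟨p, hp⟩ := ih a h.of_cons
    have hva : (⊤ : SimpleGraph V).Adj v a := by
      rintro rfl
      simp at h
    exact ⟨.cons hva p, by simp [hp]⟩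

/-- **Hamiltonian extension property of complete graphs (used in Corollary 1).**
In the complete graph on a finite vertex set with at least two elements, every path
starting at `s` that does not visit `t` can be extended to a Hamiltonian path from `s` to `t`. -/
theorem complete_graph_path_extends_to_hamiltonian
    {V : Type*} [Fintype V] [DecidableEq V] (hV : 2 ≤ Fintype.card V)
    (s t : V) (hst : s ≠ t) (v : V)
    (W : (⊤ : SimpleGraph V).Walk s v) (hW : W.IsPath) (ht : t ∉ W.support) :
    ∃ W' : (⊤ : SimpleGraph V).Walk v t,
      (W.append W').IsPath ∧ ∀ u : V, u ∈ (W.append W').support := by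
  classical
  set l := (Finset.univ \ insert t W.support.toFinset).toList with hl
  have mem_l (u : V) : u ∈ l ↔ u ≠ t ∧ u ∉ W.support := by simp [hl]
  have nodup_l : l.Nodup := Finset.nodup_toList _
  have nodup_tail : (l ++ [t]).Nodup := by
    simp [List.nodup_append, nodup_l, mem_l]
    tauto
  have hv : v ∈ W.support := W.end_mem_support
  obtain ⟨W', hW'⟩ := exists_walk_top_support_eq l v t (by
    refine List.nodup_cons.2 ⟨?_, nodup_tail⟩
    have : v ≠ t := by rintro rfl; exact ht hv
    simp [mem_l, hv, this])
  have support_eq : (W.append W').support = W.support ++ (l ++ [t]) := by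
    rw [SimpleGraph.Walk.support_append, hW', List.tail_cons]
  refine ⟨W', ?_, fun u => ?_⟩
  · rw [SimpleGraph.Walk.isPath_def, support_eq]
    refine List.Nodup.append hW.support_nodup nodup_tail fun u hu hu' => ?_
    rcases List.mem_append.1 hu' with h | h
    · exact ((mem_l u).1 h).2 hu
    · exact ht (List.mem_singleton.1 h ▸ hu)
  · simp only [support_eq, List.mem_append, List.mem_singleton, mem_l]
    tauto
end

section
/- Every path in G starting at s that does not visit t can be extended to a Hamiltonian path of G from s to t: if W is a path of G from s to some vertex v with t not in the support of W, then there exists a walk W' from v to t such that the concatenation of W and W' is a Hamiltonian path of G from s to t. (This verifies, for complete balanced bipartite graphs with start and end vertices on different sides, the hypothesis of Theorem 4, as used in Corollary 2.) -/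
namespace SimpleGraph.Walk

variable {V : Type*} {G : SimpleGraph V} {u v w : V}

theorem IsPath.append_of_disjoint {p : G.Walk u v} {q : G.Walk v w} (hp : p.IsPath)
    (hq : q.IsPath) (h : ∀ x ∈ p.support, x ∈ q.support → x = v) : (p.append q).IsPath := by
  rw [isPath_def, support_append, List.nodup_append']
  have hq' := hq.support_nodup
  rw [← cons_tail_support, List.nodup_cons] at hq'
  refine ⟨hp.support_nodup, hq'.2, fun x hxp hxq => ?_⟩
  obtain rfl := h x hxp (List.mem_of_mem_tail hxq)
  exact hq'.1 hxq

variable [DecidableEq V]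

/-- Along a path of a bipartite graph the two parts are visited equally often, up to the
contribution of the end vertices. -/
theorem IsPath.card_inter_support_of_bipartite {X Y : Finset V}
    (hG : ∀ a b, G.Adj a b → (a ∈ X ∧ b ∈ Y) ∨ (a ∈ Y ∧ b ∈ X)) (hXY : Disjoint X Y)
    {p : G.Walk u v} (hp : p.IsPath) (hv : v ∈ X ∪ Y) :
    (X ∩ p.support.toFinset).card + (if u ∈ Y then 1 else 0) =
      (Y ∩ p.support.toFinset).card + (if v ∈ X then 1 else 0) := by
  have hd : ∀ a, a ∈ X → a ∉ Y := fun _ h => Finset.disjoint_left.mp hXY h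
  induction p with
  | nil =>
    rename_i a
    by_cases ha : a ∈ X
    · simp [ha, hd a ha]
    · have : a ∈ Y := by grind
      simp [ha, this]
  | cons h p ih =>
    rename_i a b c
    rw [cons_isPath_iff] at hp
    specialize ih hp.1 hv
    rw [support_cons, List.toFinset_cons]
    rcases hG _ _ h with ⟨ha, hb⟩ | ⟨ha, hb⟩
    · have ha' := hd a ha
      rw [Finset.inter_insert_of_mem ha, Finset.inter_insert_of_notMem ha',
        Finset.card_insert_of_notMem (by simp [hp.2])]
      simp only [hb, ha', if_true, if_false] at ih ⊢
      omega
    · have ha' : a ∉ X := fun h' => hd a h' ha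
      have hb' := hd b hb
      rw [Finset.inter_insert_of_mem ha, Finset.inter_insert_of_notMem ha',
        Finset.card_insert_of_notMem (by simp [hp.2])]
      simp only [hb', ha, if_true, if_false] at ih ⊢
      omega

/-- In a graph where all vertices of `X` are adjacent to all vertices of `Y`, a vertex of `X`
is joined to `t` by a path visiting, besides its start, exactly the vertices of `A ⊆ X` and
`B ⊆ Y`, where `B` contains `t` and has one element more than `A`. -/
theorem exists_isPath_mem_support_iff {X Y : Finset V} (hG : ∀ a ∈ X, ∀ b ∈ Y, G.Adj a b)
    {t : V} (hXY : Disjoint X Y) (A B : Finset V) (hA : A ⊆ X) (hB : B ⊆ Y)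
    (hcard : B.card = A.card + 1) (ht : t ∈ B) (v : V) (hv : v ∈ X) (hvA : v ∉ A) :
    ∃ q : G.Walk v t, q.IsPath ∧ ∀ x, x ∈ q.support ↔ x = v ∨ x ∈ A ∨ x ∈ B := by
  have hd : ∀ a, a ∈ X → a ∉ Y := fun _ h => Finset.disjoint_left.mp hXY h
  induction A using Finset.induction_on generalizing B v with
  | empty =>
    obtain ⟨b, rfl⟩ := Finset.card_eq_one.mp (by simpa using hcard)
    obtain rfl := Finset.mem_singleton.mp ht
    have h := hG v hv t (hB ht)
    exact ⟨h.toWalk, by simp [h.ne], by simp⟩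
  | insert a A ha ih =>
    rw [Finset.card_insert_of_notMem ha] at hcard
    obtain ⟨b, hb, hbt⟩ := Finset.exists_mem_ne (by omega : 1 < B.card) t
    have haX : a ∈ X := hA (Finset.mem_insert_self a A)
    obtain ⟨q, hq, hqs⟩ := ih (B.erase b) ((Finset.subset_insert a A).trans hA)
      ((Finset.erase_subset b B).trans hB) (by rw [Finset.card_erase_of_mem hb]; omega)
      (Finset.mem_erase.mpr ⟨hbt.symm, ht⟩) a haX ha
    refine ⟨cons (hG v hv b (hB hb)) (cons (hG a haX b (hB hb)).symm q), ?_, ?_⟩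
    · simp only [cons_isPath_iff, support_cons, List.mem_cons, hqs]
      grind
    · simp only [support_cons, List.mem_cons, hqs]
      grind

end SimpleGraph.Walk


/-- **Hamiltonian extension property of complete balanced bipartite graphs (Corollary 2).**
In the complete bipartite graph `K_{n,n}` with parts `X` and `Y` of size `n ≥ 1`,
start vertex `s ∈ X` and end vertex `t ∈ Y`, every path starting at `s` that does not
visit `t` can be extended to a Hamiltonian path from `s` to `t`. -/
theorem complete_bipartite_balanced_path_extends_to_hamiltonian
    {V : Type*} [Fintype V] [DecidableEq V] (n : ℕ) (hn : 1 ≤ n)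
    (X Y : Finset V) (hdisj : Disjoint X Y) (hunion : X ∪ Y = Finset.univ)
    (hX : X.card = n) (hY : Y.card = n)
    (G : SimpleGraph V)
    (hG : ∀ a b : V, G.Adj a b ↔ (a ∈ X ∧ b ∈ Y) ∨ (a ∈ Y ∧ b ∈ X))
    (s t : V) (hs : s ∈ X) (ht : t ∈ Y) (v : V)
    (W : G.Walk s v) (hW : W.IsPath) (htW : t ∉ W.support) :
    ∃ W' : G.Walk v t,
      (W.append W').IsPath ∧ ∀ u : V, u ∈ (W.append W').support := by
  have hmem : ∀ a, a ∈ X ∨ a ∈ Y := fun a => by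
    rw [← Finset.mem_union, hunion]; exact Finset.mem_univ a
  have hd : ∀ a, a ∈ X → a ∉ Y := fun _ h => Finset.disjoint_left.mp hdisj h
  have hadj : ∀ a ∈ X, ∀ b ∈ Y, G.Adj a b := fun a ha b hb => (hG a b).mpr (.inl ⟨ha, hb⟩)
  have hbal := hW.card_inter_support_of_bipartite (fun a b => (hG a b).mp) hdisj
    (Finset.mem_union.mpr (hmem v))
  simp only [hd s hs, if_false] at hbal
  set S := W.support.toFinset with hS
  have hmemS : ∀ x, x ∈ S ↔ x ∈ W.support := fun x => List.mem_toFinset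
  have hcX := Finset.card_inter_add_card_sdiff X S
  have hcY := Finset.card_inter_add_card_sdiff Y S
  have htB : t ∈ Y \ S := Finset.mem_sdiff.mpr ⟨ht, by rwa [hmemS]⟩
  have hvS : v ∈ S := (hmemS v).mpr W.end_mem_support
  suffices ∃ q : G.Walk v t, q.IsPath ∧ ∀ x, x ∈ q.support ↔ x = v ∨ x ∉ S by
    obtain ⟨q, hq, hqs⟩ := this
    refine ⟨q, hW.append_of_disjoint hq fun x hx hxq => ?_, fun u => ?_⟩
    · exact ((hqs x).mp hxq).resolve_right fun h => h ((hmemS x).mpr hx)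
    · rw [SimpleGraph.Walk.mem_support_append_iff, hqs, ← hmemS]
      tauto
  by_cases hv : v ∈ X
  · simp only [hv, if_true] at hbal
    obtain ⟨q, hq, hqs⟩ := SimpleGraph.Walk.exists_isPath_mem_support_iff hadj hdisj
      (X \ S) (Y \ S) Finset.sdiff_subset Finset.sdiff_subset (by omega) htB v hv (by simp [hvS])
    refine ⟨q, hq, fun x => ?_⟩
    grind
  · simp only [hv, if_false] at hbal
    have hvY : v ∈ Y := (hmem v).resolve_left hv
    have hpos : 0 < (Y \ S).card := Finset.card_pos.mpr ⟨t, htB⟩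
    obtain ⟨a, ha⟩ := Finset.card_pos.mp (by omega : 0 < (X \ S).card)
    have haX : a ∈ X := (Finset.mem_sdiff.mp ha).1
    obtain ⟨q, hq, hqs⟩ := SimpleGraph.Walk.exists_isPath_mem_support_iff hadj hdisj
      ((X \ S).erase a) (Y \ S) ((Finset.erase_subset _ _).trans Finset.sdiff_subset)
      Finset.sdiff_subset (by rw [Finset.card_erase_of_mem ha]; omega) htB a haX (by simp)
    refine ⟨.cons (hadj a haX v hvY).symm q, ?_, fun x => ?_⟩
    · rw [SimpleGraph.Walk.cons_isPath_iff, hqs]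
      grind
    · rw [SimpleGraph.Walk.support_cons, List.mem_cons, hqs]
      grind
end

section
/- Every path in G starting at s that does not visit t can be extended to a Hamiltonian path of G from s to t: if W is a path of G from s to some vertex v with t not in the support of W, then there exists a walk W' from v to t such that the concatenation of W and W' is a Hamiltonian path of G from s to t. (This verifies, for the complete bipartite graph K_{n+1,n} with distinct start and end vertices on the bigger side, the hypothesis of Theorem 4, as used in Corollary 2.) -/
open Finset in
/-- A path in a bipartite graph alternates between the two parts, so the numbers of vertices it
visits in each part are determined up to the parts of its endpoints. -/
theorem SimpleGraph.Walk.IsPath.card_inter_support_of_bipartite_s5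
    {V : Type*} [DecidableEq V] {X Y : Finset V} (hdisj : Disjoint X Y) {G : SimpleGraph V}
    (hG : ∀ a b : V, G.Adj a b → (a ∈ X ∧ b ∈ Y) ∨ (a ∈ Y ∧ b ∈ X))
    {u v : V} {p : G.Walk u v} (hp : p.IsPath) (hv : v ∈ X ∪ Y) :
    #(X ∩ p.support.toFinset) + (if u ∈ Y then 1 else 0) + (if v ∈ Y then 1 else 0) =
      #(Y ∩ p.support.toFinset) + 1 := by
  induction p with
  | nil =>
    rcases mem_union.1 hv with h | h
    · simp [h, Finset.disjoint_left.1 hdisj h]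
    · simp [h, Finset.disjoint_right.1 hdisj h]
  | @cons a b c h p ih =>
    rw [SimpleGraph.Walk.cons_isPath_iff] at hp
    have key := ih hp.1 hv
    rw [SimpleGraph.Walk.support_cons, List.toFinset_cons]
    rcases hG _ _ h with ⟨ha, hb⟩ | ⟨ha, hb⟩
    · have ha' := Finset.disjoint_left.1 hdisj ha
      rw [inter_insert_of_mem ha, inter_insert_of_notMem ha',
        card_insert_of_notMem (by simp [hp.2])]
      simp only [ha', hb, if_true, if_false] at key ⊢
      omega
    · have ha' := Finset.disjoint_right.1 hdisj ha
      have hb' := Finset.disjoint_left.1 hdisj hb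
      rw [inter_insert_of_mem ha, inter_insert_of_notMem ha',
        card_insert_of_notMem (by simp [hp.2])]
      simp only [ha, hb', if_true, if_false] at key ⊢
      omega

/-- Unless the path already covers every vertex but `t`, it can be prolonged by one edge to a path
still avoiding `t`; otherwise its end is adjacent to `t`. -/
theorem SimpleGraph.Walk.IsPath.exists_adj_notMem_support_of_completeBipartite
    {V : Type*} [Fintype V] [DecidableEq V] {X Y : Finset V}
    (hdisj : Disjoint X Y) (hunion : X ∪ Y = Finset.univ) (hcard : X.card = Y.card + 1)
    {G : SimpleGraph V}
    (hG : ∀ a b : V, G.Adj a b ↔ (a ∈ X ∧ b ∈ Y) ∨ (a ∈ Y ∧ b ∈ X))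
    {s t v : V} (hs : s ∈ X) (ht : t ∈ X)
    {W : G.Walk s v} (hW : W.IsPath) (htW : t ∉ W.support) :
    (∃ w, G.Adj v w ∧ w ∉ W.support ∧ w ≠ t) ∨
      (G.Adj v t ∧ ∀ u, u ∈ W.support ∨ u = t) := by
  have hcover : ∀ u, u ∈ X ∨ u ∈ Y := fun u => by
    rw [← Finset.mem_union, hunion]; exact Finset.mem_univ u
  have hbal := hW.card_inter_support_of_bipartite_s5 hdisj (fun a b => (hG a b).1)
    (Finset.mem_union.2 (hcover v))
  rw [if_neg (Finset.disjoint_left.1 hdisj hs)] at hbal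
  have hsub : X ∩ W.support.toFinset ⊆ X.erase t := fun x hx => by
    simp only [Finset.mem_inter, List.mem_toFinset] at hx
    exact Finset.mem_erase.2 ⟨fun h => htW (h ▸ hx.2), hx.1⟩
  have hle := Finset.card_le_card hsub
  have herase := Finset.card_erase_of_mem ht
  rcases hcover v with hv | hv
  · left
    rw [if_neg (Finset.disjoint_left.1 hdisj hv)] at hbal
    obtain ⟨w, hwY, hw⟩ : ∃ w ∈ Y, w ∉ Y ∩ W.support.toFinset :=
      Finset.exists_mem_notMem_of_card_lt_card (by omega)
    refine ⟨w, (hG v w).2 (Or.inl ⟨hv, hwY⟩), fun h => hw (by simp [hwY, h]), ?_⟩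
    rintro rfl
    exact Finset.disjoint_left.1 hdisj ht hwY
  · rw [if_pos hv] at hbal
    by_cases hlt : (X ∩ W.support.toFinset).card < (X.erase t).card
    · left
      obtain ⟨w, hwX, hw⟩ := Finset.exists_mem_notMem_of_card_lt_card hlt
      rw [Finset.mem_erase] at hwX
      exact ⟨w, (hG v w).2 (Or.inr ⟨hv, hwX.2⟩), fun h => hw (by simp [hwX.2, h]), hwX.1⟩
    · right
      refine ⟨(hG v t).2 (Or.inr ⟨hv, ht⟩), fun u => ?_⟩
      have hXeq := Finset.eq_of_subset_of_card_le hsub (by omega)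
      have hYeq : Y ∩ W.support.toFinset = Y :=
        Finset.eq_of_subset_of_card_le Finset.inter_subset_left (by omega)
      rcases hcover u with hu | hu
      · by_cases hut : u = t
        · exact Or.inr hut
        · have : u ∈ X ∩ W.support.toFinset := hXeq ▸ Finset.mem_erase.2 ⟨hut, hu⟩
          simp only [Finset.mem_inter, List.mem_toFinset] at this
          exact Or.inl this.2
      · rw [← hYeq] at hu
        simp only [Finset.mem_inter, List.mem_toFinset] at hu
        exact Or.inl hu.2


/-- **Hamiltonian extension property of `K_{n+1,n}` (Corollary 2).**
In the complete bipartite graph `K_{n+1,n}` with parts `X` of size `n+1` and `Y` of size `n`,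
and distinct start and end vertices `s, t ∈ X`, every path starting at `s` that does not
visit `t` can be extended to a Hamiltonian path from `s` to `t`. -/
theorem complete_bipartite_unbalanced_path_extends_to_hamiltonian
    {V : Type*} [Fintype V] [DecidableEq V] (n : ℕ) (hn : 1 ≤ n)
    (X Y : Finset V) (hdisj : Disjoint X Y) (hunion : X ∪ Y = Finset.univ)
    (hX : X.card = n + 1) (hY : Y.card = n)
    (G : SimpleGraph V)
    (hG : ∀ a b : V, G.Adj a b ↔ (a ∈ X ∧ b ∈ Y) ∨ (a ∈ Y ∧ b ∈ X))
    (s t : V) (hs : s ∈ X) (ht : t ∈ X) (hst : s ≠ t) (v : V)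
    (W : G.Walk s v) (hW : W.IsPath) (htW : t ∉ W.support) :
    ∃ W' : G.Walk v t,
      (W.append W').IsPath ∧ ∀ u : V, u ∈ (W.append W').support := by
  induction hk : Fintype.card V - W.length using Nat.strong_induction_on generalizing v with
  | _ k ih =>
    rcases hW.exists_adj_notMem_support_of_completeBipartite hdisj hunion (by omega) hG hs ht htW
      with ⟨w, hadj, hw, hwt⟩ | ⟨hadj, hcov⟩
    · have hlen := hW.length_lt
      obtain ⟨W', hW', hsupp⟩ := ih _ (by rw [SimpleGraph.Walk.length_concat]; omega) w
        (W.concat hadj) (hW.concat hw hadj)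
        (by simp [SimpleGraph.Walk.support_concat, htW, hwt.symm]) rfl
      rw [SimpleGraph.Walk.concat_append] at hW' hsupp
      exact ⟨.cons hadj W', hW', hsupp⟩
    · refine ⟨.cons hadj .nil, ?_, fun u => ?_⟩
      · rw [← SimpleGraph.Walk.concat_eq_append]
        exact hW.concat htW hadj
      · rw [← SimpleGraph.Walk.concat_eq_append, SimpleGraph.Walk.support_concat]
        simpa using hcov u
end

section
/- The minimum estimated cost over all candidate walks equals (min over u ∈ U with u ≠ t of w(v,u)) + α·(|U| − 1); in particular, this minimum is attained by a walk that visits no vertex twice, which first moves to a vertex of U \ {t} at minimal revealed distance from v and then follows a Hamiltonian path on the remaining unvisited vertices ending at t. (Lemma 6: in this setting the adaptive exploration algorithm takes the cheapest outgoing edge towards an unvisited vertex which is not the end vertex, and never visits a vertex twice.) -/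
open Finset

/-- A candidate walk of the adaptive exploration algorithm: a finite nonempty sequence of
vertices starting at the current vertex `v`, ending at the end vertex `t`, with consecutive
vertices distinct, that visits every unvisited vertex (every vertex of `Sᶜ`). -/
def IsCandidate {V : Type*} [Fintype V] [DecidableEq V]
    (S : Finset V) (v t : V) (L : List V) : Prop :=
  L.head? = some v ∧ L.getLast? = some t ∧ L.Chain' (· ≠ ·) ∧ ∀ u ∈ (Sᶜ : Finset V), u ∈ L

/-- The worst-case estimated cost of a candidate walk: revealed pairs (at least one endpoint
visited) cost their actual weight, unrevealed pairs cost `α`. -/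
noncomputable def estCost {V : Type*} [DecidableEq V]
    (S : Finset V) (w : V → V → ℝ) (α : ℝ) (L : List V) : ℝ :=
  ((L.zip L.tail).map fun p => if p.1 ∈ S ∨ p.2 ∈ S then w p.1 p.2 else α).sum

theorem estCost_cons_cons {V : Type*} [DecidableEq V] (S : Finset V) (w : V → V → ℝ) (α : ℝ)
    (x y : V) (L : List V) :
    estCost S w α (x :: y :: L) =
      (if x ∈ S ∨ y ∈ S then w x y else α) + estCost S w α (y :: L) := by
  simp [estCost]

theorem estCost_singleton {V : Type*} [DecidableEq V] (S : Finset V) (w : V → V → ℝ) (α : ℝ)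
    (x : V) : estCost S w α [x] = 0 := by
  simp [estCost]

/-- Every unvisited vertex entered along a walk accounts for a cost of at least `α`, up to a
credit of `1` if the walk starts at a visited vertex. -/
theorem mul_countP_le_estCost {V : Type*} [DecidableEq V] {S : Finset V} {w : V → V → ℝ} {α : ℝ}
    (hα2 : α ≤ 2) (hlb : ∀ x y : V, x ≠ y → 1 ≤ w x y) (L : List V) (x : V)
    (hL : (x :: L).IsChain (· ≠ ·)) :
    α * (L.countP (· ∉ S) : ℝ) ≤ estCost S w α (x :: L) + if x ∈ S then 1 else 0 := by
  induction L generalizing x with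
  | nil => rw [estCost_singleton]; split_ifs <;> simp
  | cons y L ih =>
    rw [List.isChain_cons_cons] at hL
    have h := ih y hL.2
    have hxy := hlb x y hL.1
    rw [estCost_cons_cons, List.countP_cons]
    by_cases hx : x ∈ S <;> by_cases hy : y ∈ S <;> simp [hx, hy] at h ⊢ <;> linarith

theorem estCost_of_forall_notMem {V : Type*} [DecidableEq V] {S : Finset V} {w : V → V → ℝ}
    {α : ℝ} (L : List V) (x : V) (hL : ∀ y ∈ x :: L, y ∉ S) :
    estCost S w α (x :: L) = α * L.length := by
  induction L generalizing x with
  | nil => simp [estCost_singleton]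
  | cons y L ih =>
    rw [estCost_cons_cons, ih y fun z hz => hL z (List.mem_cons_of_mem _ hz),
      if_neg (by simp [hL x, hL y])]
    push_cast [List.length_cons]
    ring

theorem card_le_countP_of_subset {V : Type*} [DecidableEq V] {A : Finset V} {L : List V}
    {p : V → Prop} [DecidablePred p] (hp : ∀ a ∈ A, p a) (hA : ∀ a ∈ A, a ∈ L) :
    A.card ≤ L.countP (p ·) := by
  rw [List.countP_eq_length_filter]
  refine le_trans (Finset.card_le_card fun a ha => ?_) (List.toFinset_card_le _)
  simp [hp a ha, hA a ha]

theorem le_estCost_of_isCandidate {V : Type*} [Fintype V] [DecidableEq V] {α : ℝ}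
    (hα1 : 1 ≤ α) (hα2 : α ≤ 2) {w : V → V → ℝ}
    (hlb : ∀ x y : V, x ≠ y → 1 ≤ w x y) {S : Finset V} {v t : V} (hv : v ∈ S)
    (ht : t ∈ (Sᶜ : Finset V)) (hne : ((Sᶜ : Finset V).erase t).Nonempty) {μ : ℝ} (hμα : μ ≤ α)
    (hμ : ∀ u ∈ (Sᶜ : Finset V).erase t, μ ≤ w v u) {L : List V} (hL : IsCandidate S v t L) :
    μ + α * (((Sᶜ : Finset V).card : ℝ) - 1) ≤ estCost S w α L := by
  obtain ⟨hhead, hlast, hchain, hcover⟩ := hL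
  have htS : t ∉ S := by simpa using ht
  match L with
  | [] => simp at hhead
  | [x] =>
    simp only [List.head?_cons, Option.some.injEq, List.getLast?_singleton] at hhead hlast
    exact absurd hv (by rwa [← hhead, hlast])
  | x :: y :: R =>
    obtain rfl : x = v := by simpa using hhead
    replace hchain : (x :: y :: R).IsChain (· ≠ ·) := hchain
    rw [List.isChain_cons_cons] at hchain
    have hcost := mul_countP_le_estCost (S := S) hα2 hlb R y hchain.2
    have hxy := hlb x y hchain.1
    have hmem : ∀ a ∈ (Sᶜ : Finset V), a ≠ y → a ∈ R := by
      intro a ha hay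
      have hax : a ≠ x := by rintro rfl; exact (Finset.mem_compl.1 ha) hv
      simpa [hax, hay] using hcover a ha
    rw [estCost_cons_cons, if_pos (Or.inl hv)]
    by_cases hcov : ∀ a ∈ (Sᶜ : Finset V), a ∈ R
    · have hcard : ((Sᶜ : Finset V).card : ℝ) ≤ R.countP (· ∉ S) := by
        exact_mod_cast card_le_countP_of_subset (fun a ha => Finset.mem_compl.1 ha) hcov
      have := mul_le_mul_of_nonneg_left hcard (by linarith : 0 ≤ α)
      split_ifs at hcost <;> linarith
    · have hyS : y ∈ (Sᶜ : Finset V) := by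
        by_contra hy
        exact hcov fun a ha => hmem a ha (by rintro rfl; exact hy ha)
      have hyt : y ≠ t := by
        rintro rfl
        obtain ⟨a, ha⟩ := hne
        rw [Finset.mem_erase] at ha
        refine hcov fun b hb => ?_
        by_cases hby : b = y
        · subst hby
          have hR := List.ne_nil_of_mem (hmem a ha.2 ha.1)
          obtain ⟨z, R, rfl⟩ := List.exists_cons_of_ne_nil hR
          rw [List.getLast?_cons_cons, List.getLast?_cons_cons] at hlast
          exact List.mem_of_getLast? hlast
        · exact hmem b hb hby
      have hcard : ((Sᶜ : Finset V).erase y).card ≤ R.countP (· ∉ S) :=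
        card_le_countP_of_subset
          (fun a ha => Finset.mem_compl.1 (Finset.mem_of_mem_erase ha))
          fun a ha => hmem a (Finset.mem_of_mem_erase ha) (Finset.ne_of_mem_erase ha)
      have hcard' : ((Sᶜ : Finset V).card : ℝ) - 1 ≤ R.countP (· ∉ S) := by
        rw [← Finset.cast_card_erase_of_mem hyS]
        exact_mod_cast hcard
      have := mul_le_mul_of_nonneg_left hcard' (by linarith : 0 ≤ α)
      have := hμ y (Finset.mem_erase.2 ⟨hyt, hyS⟩)
      rw [if_neg (Finset.mem_compl.1 hyS)] at hcost
      linarith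

/-- **Lemma 6.**
With visited set `S`, current vertex `v ∈ S`, unvisited set `U = Sᶜ` with `|U| ≥ 2`,
end vertex `t ∈ U`, and actual weights `1 ≤ w x y ≤ α` (`1 ≤ α < 2`): the minimum
estimated cost over all candidate walks equals
`(min over u ∈ U \ {t} of w v u) + α · (|U| - 1)`, and this minimum is attained by a
walk visiting no vertex twice that first moves to a vertex of `U \ {t}` at minimal
revealed distance from `v` and then visits the remaining unvisited vertices, ending at `t`. -/
theorem adaptive_algorithm_takes_cheapest_edge
    {V : Type*} [Fintype V] [DecidableEq V]
    (α : ℝ) (hα1 : 1 ≤ α) (hα2 : α < 2)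
    (w : V → V → ℝ) (hsymm : ∀ x y : V, w x y = w y x)
    (hlb : ∀ x y : V, x ≠ y → 1 ≤ w x y) (hub : ∀ x y : V, x ≠ y → w x y ≤ α)
    (S : Finset V) (v : V) (hv : v ∈ S)
    (hU : 2 ≤ (Sᶜ : Finset V).card) (t : V) (ht : t ∈ (Sᶜ : Finset V))
    (hne : ((Sᶜ : Finset V).erase t).Nonempty) :
    IsLeast {c : ℝ | ∃ L : List V, IsCandidate S v t L ∧ estCost S w α L = c}
        (((Sᶜ : Finset V).erase t).inf' hne (w v) +
          α * (((Sᶜ : Finset V).card : ℝ) - 1)) ∧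
      ∃ (u : V) (rest : List V), u ∈ (Sᶜ : Finset V).erase t ∧
        w v u = ((Sᶜ : Finset V).erase t).inf' hne (w v) ∧
        IsCandidate S v t (v :: u :: rest) ∧ (v :: u :: rest).Nodup ∧
        estCost S w α (v :: u :: rest) =
          ((Sᶜ : Finset V).erase t).inf' hne (w v) +
            α * (((Sᶜ : Finset V).card : ℝ) - 1) := by
  obtain ⟨u, hu, huw⟩ := Finset.exists_mem_eq_inf' hne (w v)
  have hvU : ∀ a ∈ (Sᶜ : Finset V), v ≠ a := by
    rintro a ha rfl
    exact Finset.mem_compl.1 ha hv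
  obtain ⟨hut, huU⟩ := Finset.mem_erase.1 hu
  set R := (((Sᶜ : Finset V).erase t).erase u).toList ++ [t] with hR
  have hmem : ∀ a, a ∈ u :: R ↔ a ∈ (Sᶜ : Finset V) := by
    intro a
    simp only [hR, List.mem_cons, List.mem_append, Finset.mem_toList, Finset.mem_erase,
      List.not_mem_nil, or_false]
    by_cases hau : a = u
    · simp [hau, huU]
    · by_cases hat : a = t <;> simp [hau, hat, ht]
  have hnodup : (v :: u :: R).Nodup := by
    rw [List.nodup_cons]
    refine ⟨fun h => hvU v ((hmem v).1 h) rfl, ?_⟩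
    simp +contextual [hR, List.nodup_append, Finset.nodup_toList, hut]
  have hlen : ((R.length : ℕ) : ℝ) = ((Sᶜ : Finset V).card : ℝ) - 1 := by
    rw [hR, List.length_append, Finset.length_toList, List.length_singleton,
      Nat.cast_add, Finset.cast_card_erase_of_mem hu, Finset.cast_card_erase_of_mem ht]
    simp
  have hcand : IsCandidate S v t (v :: u :: R) :=
    ⟨rfl, by simp [hR, List.getLast?_cons], List.Pairwise.isChain hnodup,
      fun a ha => List.mem_cons_of_mem _ ((hmem a).2 ha)⟩
  have hcost : estCost S w α (v :: u :: R) =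
      ((Sᶜ : Finset V).erase t).inf' hne (w v) + α * (((Sᶜ : Finset V).card : ℝ) - 1) := by
    rw [estCost_cons_cons, if_pos (Or.inl hv), ← huw, ← hlen,
      estCost_of_forall_notMem R u fun a ha => Finset.mem_compl.1 ((hmem a).1 ha)]
  refine ⟨⟨⟨_, hcand, hcost⟩, ?_⟩, u, R, hu, huw.symm, hcand, hnodup, hcost⟩
  rintro _ ⟨L, hL, rfl⟩
  exact le_estCost_of_isCandidate hα1 hα2.le hlb hv ht hne (huw ▸ hub v u (hvU u huU))
    (fun a ha => Finset.inf'_le _ ha) hL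
end
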